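/- Let $P$ be a finite set of points in the Euclidean plane $\mathbb{R}^2$ and $r > 0$, and consider the geometric graph $G$ on $P$ in which two distinct points $p, q$ are joined by the straight segment $[p,q]$ if and only if $\|p-q\| \le r$. Two segments *cross* if they have a common point that is distinct from all four of their endpoints. An *anchor* of $G$ consists of four distinct points $a, b, c, d \in P$ with $\|a-b\| \le r$, $\|a-c\| \le r$, $\|a-d\| \le r$, $\|c-d\| \le r$ such that the segments $[a,b]$ and $[c,d]$ cross. Then: 1. $G$ has two crossing edges without a common endpoint if and only if $G$ has an anchor. 2. Suppose that no point of $P$ lies in the interior of an edge of $G$ (for instance, that no three points of $P$ are collinear). Then $G$ is plane, i.e. no two distinct edges of $G$ cross, if and only if $G$ has no anchor. -/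

import Mathlib

/-- The Euclidean plane. -/
abbrev Plane : Type := EuclideanSpace ℝ (Fin 2)

/-- Two segments `[a,b]` and `[c,d]` cross if they have a common point that is interior to
both segments, i.e. lies on each segment and is distinct from its endpoints. -/
def Crosses (a b c d : Plane) : Prop :=
  ∃ p, (p ∈ segment ℝ a b ∧ p ≠ a ∧ p ≠ b) ∧ (p ∈ segment ℝ c d ∧ p ≠ c ∧ p ≠ d)

/-- The disk graph on `P`: two distinct points are adjacent iff their distance is at most `r`.
The edge between `p` and `q` is drawn as the segment `[p,q]`. -/
def diskGraph (P : Set Plane) (r : ℝ) : SimpleGraph P where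
  Adj p q := p ≠ q ∧ dist (p : Plane) (q : Plane) ≤ r
  symm := ⟨fun _ _ h => ⟨h.1.symm, by rw [dist_comm]; exact h.2⟩⟩
  loopless := ⟨fun _ h => h.1 rfl⟩

/-- A geometric graph is plane if no two distinct edges cross. The edges may have a common
endpoint, so collinear overlaps of such edges count as crossings. -/
def IsPlane {P : Set Plane} (G : SimpleGraph P) : Prop :=
  ∀ p q s t : P, G.Adj p q → G.Adj s t → s(p, q) ≠ s(s, t) → ¬ Crosses p q s t

/-- Some two edges without a common endpoint cross. -/
def HasDisjointCrossing {P : Set Plane} (G : SimpleGraph P) : Prop :=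
  ∃ p q s t : P, G.Adj p q ∧ G.Adj s t ∧ p ≠ s ∧ p ≠ t ∧ q ≠ s ∧ q ≠ t ∧ Crosses p q s t

/-- No vertex lies in the interior of an edge. -/
def NoVertexInsideEdge {P : Set Plane} (G : SimpleGraph P) : Prop :=
  ∀ p q v : P, G.Adj p q → (v : Plane) ∈ segment ℝ (p : Plane) (q : Plane) → v = p ∨ v = q

/-- Four distinct points of `P` form an anchor with crown `a`. -/
def HasAnchor (P : Set Plane) (r : ℝ) : Prop :=
  ∃ a ∈ P, ∃ b ∈ P, ∃ c ∈ P, ∃ d ∈ P,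
    a ≠ b ∧ a ≠ c ∧ a ≠ d ∧ b ≠ c ∧ b ≠ d ∧ c ≠ d ∧
    dist a b ≤ r ∧ dist a c ≤ r ∧ dist a d ≤ r ∧ dist c d ≤ r ∧ Crosses a b c d

theorem Crosses.symm {a b c d : Plane} (h : Crosses a b c d) : Crosses c d a b :=
  let ⟨p, h₁, h₂⟩ := h
  ⟨p, h₂, h₁⟩

theorem Crosses.swap_left {a b c d : Plane} (h : Crosses a b c d) : Crosses b a c d := by
  obtain ⟨p, ⟨h, ha, hb⟩, h₂⟩ := h
  exact ⟨p, ⟨segment_symm ℝ a b ▸ h, hb, ha⟩, h₂⟩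

theorem Crosses.swap_right {a b c d : Plane} (h : Crosses a b c d) : Crosses a b d c :=
  h.symm.swap_left.symm

/-- Two opposite sides of a quadrilateral with crossing diagonals are together at most as long
as the diagonals. -/
theorem Crosses.dist_add_dist_le {a b c d : Plane} (h : Crosses a b c d) :
    dist a c + dist b d ≤ dist a b + dist c d := by
  obtain ⟨x, ⟨hab, -, -⟩, hcd, -, -⟩ := h
  have h₁ := dist_add_dist_of_mem_segment hab
  have h₂ := dist_add_dist_of_mem_segment hcd
  have h₃ := dist_triangle a x c
  have h₄ := dist_triangle b x d
  rw [dist_comm b x] at h₄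
  rw [dist_comm c x] at h₂
  linarith

/-- If two segments with a common endpoint cross, then one of them contains the other. -/
theorem Crosses.mem_segment_or_mem_segment {a b c : Plane} (h : Crosses a b a c) :
    b ∈ segment ℝ a c ∨ c ∈ segment ℝ a b := by
  obtain ⟨x, ⟨hb, hxa, -⟩, hc, -, -⟩ := h
  simp only [mem_segment_iff_wbtw] at *
  refine wbtw_total_of_sameRay_vsub_left
    (hb.sameRay_vsub_left.symm.trans hc.sameRay_vsub_left fun h0 => ?_)
  exact absurd (vsub_eq_zero_iff_eq.1 h0) hxa

theorem HasDisjointCrossing.hasAnchor {P : Set Plane} {r : ℝ}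
    (h : HasDisjointCrossing (diskGraph P r)) : HasAnchor P r := by
  obtain ⟨⟨p, hp⟩, ⟨q, hq⟩, ⟨s, hs⟩, ⟨t, ht⟩, ⟨hpq, dpq⟩, ⟨hst, dst⟩, hps, hpt, hqs, hqt, hX⟩ := h
  simp only [ne_eq, Subtype.mk.injEq] at *
  have h₁ : dist p s ≤ r ∨ dist q t ≤ r := by
    by_contra! h
    linarith [hX.dist_add_dist_le]
  have h₂ : dist p t ≤ r ∨ dist q s ≤ r := by
    by_contra! h
    linarith [hX.swap_right.dist_add_dist_le, dist_comm s t]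
  rcases h₁ with h₁ | h₁ <;> rcases h₂ with h₂ | h₂
  · exact ⟨p, hp, q, hq, s, hs, t, ht, hpq, hps, hpt, hqs, hqt, hst, dpq, h₁, h₂, dst, hX⟩
  · exact ⟨s, hs, t, ht, p, hp, q, hq, hst, Ne.symm hps, Ne.symm hqs, Ne.symm hpt, Ne.symm hqt,
      hpq, dst, dist_comm p s ▸ h₁, dist_comm q s ▸ h₂, dpq, hX.symm⟩
  · exact ⟨t, ht, s, hs, p, hp, q, hq, Ne.symm hst, Ne.symm hpt, Ne.symm hqt, Ne.symm hps,
      Ne.symm hqs, hpq, dist_comm s t ▸ dst, dist_comm p t ▸ h₂, dist_comm q t ▸ h₁, dpq,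
      hX.symm.swap_left⟩
  · exact ⟨q, hq, p, hp, s, hs, t, ht, Ne.symm hpq, hqs, hqt, hps, hpt, hst,
      dist_comm p q ▸ dpq, h₂, h₁, dst, hX.swap_left⟩

theorem HasAnchor.hasDisjointCrossing {P : Set Plane} {r : ℝ} (h : HasAnchor P r) :
    HasDisjointCrossing (diskGraph P r) := by
  obtain ⟨a, ha, b, hb, c, hc, d, hd, hab, hac, had, hbc, hbd, hcd, dab, -, -, dcd, hX⟩ := h
  refine ⟨⟨a, ha⟩, ⟨b, hb⟩, ⟨c, hc⟩, ⟨d, hd⟩, ⟨?_, dab⟩, ⟨?_, dcd⟩, ?_, ?_, ?_, ?_, hX⟩ <;>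
    simpa only [ne_eq, Subtype.mk.injEq]

theorem HasDisjointCrossing.not_isPlane {P : Set Plane} {G : SimpleGraph P}
    (h : HasDisjointCrossing G) : ¬ IsPlane G := by
  obtain ⟨p, q, s, t, hpq, hst, hps, hpt, -, -, hX⟩ := h
  intro hG
  refine hG p q s t hpq hst (fun he => ?_) hX
  rcases Sym2.eq_iff.1 he with ⟨h, -⟩ | ⟨h, -⟩
  · exact hps h
  · exact hpt h

/-- If no vertex lies inside an edge, then distinct edges with a common endpoint do not cross. -/
theorem NoVertexInsideEdge.not_crosses {P : Set Plane} {G : SimpleGraph P}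
    (hG : NoVertexInsideEdge G) {p q t : P} (hpq : G.Adj p q) (hpt : G.Adj p t) (hqt : q ≠ t) :
    ¬ Crosses p q p t := by
  intro h
  rcases h.mem_segment_or_mem_segment with h | h
  · exact (hG p t q hpt h).elim hpq.ne' hqt
  · exact (hG p q t hpq h).elim hpt.ne' hqt.symm

theorem NoVertexInsideEdge.isPlane_iff {P : Set Plane} {G : SimpleGraph P}
    (hG : NoVertexInsideEdge G) : IsPlane G ↔ ¬ HasDisjointCrossing G := by
  refine ⟨fun h h' => h'.not_isPlane h, fun h p q s t hpq hst hne hX => ?_⟩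
  by_cases hps : p = s
  · subst hps
    exact hG.not_crosses hpq hst (fun e => hne (by rw [e])) hX
  by_cases hpt : p = t
  · subst hpt
    exact hG.not_crosses hpq hst.symm (fun e => hne (by rw [e, Sym2.eq_swap])) hX.swap_right
  by_cases hqs : q = s
  · subst hqs
    exact hG.not_crosses hpq.symm hst (fun e => hne (by rw [e, Sym2.eq_swap])) hX.swap_left
  by_cases hqt : q = t
  · subst hqt
    exact hG.not_crosses hpq.symm hst.symm (fun e => hne (by rw [e])) hX.swap_left.swap_right
  exact h ⟨p, q, s, t, hpq, hst, hps, hpt, hqs, hqt, hX⟩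

theorem crossing_iff_anchor (P : Set Plane) (hP : P.Finite) (r : ℝ) (hr : 0 < r) :
    (HasDisjointCrossing (diskGraph P r) ↔ HasAnchor P r) ∧
      (NoVertexInsideEdge (diskGraph P r) → (IsPlane (diskGraph P r) ↔ ¬ HasAnchor P r)) := by
  have h : HasDisjointCrossing (diskGraph P r) ↔ HasAnchor P r :=
    ⟨HasDisjointCrossing.hasAnchor, HasAnchor.hasDisjointCrossing⟩
  exact ⟨h, fun hG => hG.isPlane_iff.trans (not_congr h)⟩
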